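/- arXiv:1902.08774 — 2 statements merged into one kernel-verified Lean document; each statement's English description precedes it below -/
import Mathlib

section
/- Let n ≥ 1 and k ≥ 0 be integers and let e_1, …, e_{n+1} denote the standard basis of ℝ^{n+1}. The number of lattice points v ∈ ℤ^{n+1} lying in the dilate k·P_{A_n} of the root lattice polytope P_{A_n} = conv{e_i − e_j : 1 ≤ i, j ≤ n+1, i ≠ j} equals ∑_{j=0}^{n} C(n,j)² · C(n + k − j, n), where C(a,b) denotes the binomial coefficient a choose b (with C(a,b) = 0 when a < b). -/
open Pointwise

theorem natCard_sum_le (α : Type*) [Fintype α] (m : ℕ) :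
    Nat.card {u : α → ℕ // ∑ i, u i ≤ m} = (m + Fintype.card α).choose (Fintype.card α) := by
  classical
  have e : {u : α → ℕ // ∑ i, u i ≤ m} ≃ {u : Option α → ℕ // ∑ i, u i = m} :=
    { toFun := fun u => ⟨fun o => o.elim (m - ∑ i, u.1 i) u.1, by
        have := u.2
        simp only [Fintype.sum_option, Option.elim]
        omega⟩
      invFun := fun u => ⟨fun i => u.1 (some i), by
        have := u.2
        rw [Fintype.sum_option] at this
        dsimp only
        omega⟩
      left_inv := fun u => rfl
      right_inv := fun u => by
        have := u.2
        rw [Fintype.sum_option] at this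
        ext o
        cases o
        · simp only [Option.elim]
          omega
        · rfl }
  rw [Nat.card_congr e, ← Nat.card_congr (Sym.equivNatSumOfFintype (Option α) m),
    Nat.card_eq_fintype_card, Sym.card_sym_eq_choose, Fintype.card_option,
    show Fintype.card α + 1 + m - 1 = m + Fintype.card α by omega, Nat.choose_symm_add]

theorem natCard_sum_add_one_le (α : Type*) [Fintype α] (m : ℕ) :
    Nat.card {u : α → ℕ // ∑ i, (u i + 1) ≤ m} = m.choose (Fintype.card α) := by
  have h (u : α → ℕ) : ∑ i, (u i + 1) = ∑ i, u i + Fintype.card α := by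
    simp [Finset.sum_add_distrib]
  simp only [h]
  rcases le_or_gt (Fintype.card α) m with hm | hm
  · simp only [← Nat.le_sub_iff_add_le hm]
    rw [natCard_sum_le, Nat.sub_add_cancel hm]
  · rw [Nat.choose_eq_zero_of_lt hm]
    have : IsEmpty {u : α → ℕ // ∑ i, u i + Fintype.card α ≤ m} := ⟨fun u => by
      have := u.2
      omega⟩
    exact Nat.card_of_isEmpty

section SignedCount

variable {ι : Type*} [Fintype ι] [DecidableEq ι]

theorem sum_eq_sum_mem_add_sum_notMem {M : Type*} [AddCommMonoid M] (S : Finset ι) (f : ι → M) :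
    ∑ i, f i = ∑ i : {i // i ∈ S}, f i + ∑ i : {i // i ∉ S}, f i := by
  rw [← Fintype.sum_subtype_add_sum_subtype (· ∈ S) f]
  congr!

/-- Integer vectors with prescribed positive support split into their positive and negative
parts. -/
def positiveSupportEquiv (S : Finset ι) (k : ℕ) :
    {w : ι → ℤ // (∑ i, max (w i) 0 ≤ k ∧ ∑ i, max (-w i) 0 ≤ k) ∧ ∀ i, i ∈ S ↔ 0 < w i} ≃
      {u : {i // i ∈ S} → ℕ // ∑ i, (u i + 1) ≤ k} ×
        {u : {i // i ∉ S} → ℕ // ∑ i, u i ≤ k} where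
  toFun w :=
    (⟨fun i => (w.1 i - 1).toNat, by
      obtain ⟨w, ⟨h₁, h₂⟩, h₃⟩ := w
      zify
      refine le_trans (le_of_eq ?_) h₁
      rw [sum_eq_sum_mem_add_sum_notMem S, Finset.sum_eq_zero (s := (Finset.univ :
        Finset {i // i ∉ S})), add_zero]
      · refine Finset.sum_congr rfl fun i _ => ?_
        have := (h₃ i).1 i.2
        omega
      · intro i _
        have := mt (h₃ i).2 i.2
        omega⟩,
    ⟨fun i => (-w.1 i).toNat, by
      obtain ⟨w, ⟨h₁, h₂⟩, h₃⟩ := w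
      zify
      refine le_trans (le_of_eq ?_) h₂
      rw [sum_eq_sum_mem_add_sum_notMem S, Finset.sum_eq_zero (s := (Finset.univ :
        Finset {i // i ∈ S})), zero_add]
      · refine Finset.sum_congr rfl fun i _ => ?_
        omega
      · intro i _
        have := (h₃ i).1 i.2
        omega⟩)
  invFun u :=
    ⟨fun i => if h : i ∈ S then (u.1.1 ⟨i, h⟩ : ℤ) + 1 else -(u.2.1 ⟨i, h⟩ : ℤ), by
      obtain ⟨⟨u, hu⟩, ⟨v, hv⟩⟩ := u
      zify at hu hv
      refine ⟨⟨le_trans (le_of_eq ?_) hu, le_trans (le_of_eq ?_) hv⟩, fun i => ?_⟩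
      · rw [sum_eq_sum_mem_add_sum_notMem S, Finset.sum_eq_zero (s := (Finset.univ :
          Finset {i // i ∉ S})), add_zero]
        · refine Finset.sum_congr rfl fun i _ => ?_
          simp only [i.2, dite_true, Subtype.coe_eta]
          omega
        · intro i _
          simp only [i.2, dite_false, Subtype.coe_eta]
          omega
      · rw [sum_eq_sum_mem_add_sum_notMem S, Finset.sum_eq_zero (s := (Finset.univ :
          Finset {i // i ∈ S})), zero_add]
        · refine Finset.sum_congr rfl fun i _ => ?_
          simp only [i.2, dite_false, Subtype.coe_eta]
          omega
        · intro i _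
          simp only [i.2, dite_true, Subtype.coe_eta]
          omega
      · by_cases h : i ∈ S
        · simp only [h, dite_true, true_iff]
          omega
        · simp only [h, dite_false, false_iff]
          omega⟩
  left_inv w := by
    obtain ⟨w, h, h₃⟩ := w
    ext i
    have := h₃ i
    by_cases hi : i ∈ S <;> simp only [hi, dite_true, dite_false, true_iff, false_iff] at this ⊢ <;>
      omega
  right_inv u := by
    obtain ⟨⟨u, hu⟩, ⟨v, hv⟩⟩ := u
    ext i
    · simp [i.2]
    · simp [i.2]

theorem natCard_posPart_negPart_le (k : ℕ) :
    Nat.card {w : ι → ℤ // ∑ i, max (w i) 0 ≤ k ∧ ∑ i, max (-w i) 0 ≤ k} =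
      ∑ j ∈ Finset.range (Fintype.card ι + 1), (Fintype.card ι).choose j *
        (k.choose j * (k + (Fintype.card ι - j)).choose (Fintype.card ι - j)) := by
  have (S : Finset ι) : Finite {u : {i // i ∈ S} → ℕ // ∑ i, (u i + 1) ≤ k} :=
    Set.Finite.subset (Set.finite_Iic fun _ => k) fun u hu i =>
      ((Nat.le_succ _).trans
        (Finset.single_le_sum (f := fun i => u i + 1) (by simp) (Finset.mem_univ i))).trans hu
  have (S : Finset ι) : Finite {u : {i // i ∉ S} → ℕ // ∑ i, u i ≤ k} :=
    Set.Finite.subset (Set.finite_Iic fun _ => k) fun u hu i =>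
      (Finset.single_le_sum (f := u) (by simp) (Finset.mem_univ i)).trans hu
  let e : {w : ι → ℤ // ∑ i, max (w i) 0 ≤ k ∧ ∑ i, max (-w i) 0 ≤ k} ≃
      Σ S : Finset ι, {w : ι → ℤ //
        (∑ i, max (w i) 0 ≤ k ∧ ∑ i, max (-w i) 0 ≤ k) ∧ ∀ i, i ∈ S ↔ 0 < w i} :=
    { toFun := fun w => ⟨Finset.univ.filter fun i => 0 < w.1 i, w.1, w.2, by simp⟩
      invFun := fun w => ⟨w.2.1, w.2.2.1⟩
      left_inv := fun w => rfl
      right_inv := fun ⟨S, w, h, h₃⟩ => by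
        obtain rfl : S = Finset.univ.filter fun i => 0 < w i := by
          ext i
          simp [h₃]
        rfl }
  rw [Nat.card_congr (e.trans (Equiv.sigmaCongrRight fun S => positiveSupportEquiv S k)),
    Nat.card_sigma]
  simp only [Nat.card_prod, natCard_sum_le, natCard_sum_add_one_le, Fintype.card_coe,
    Fintype.card_subtype_compl]
  rw [← Finset.powerset_univ, Finset.sum_powerset_apply_card (fun j =>
    k.choose j * (k + (Fintype.card ι - j)).choose (Fintype.card ι - j))]
  simp [Finset.card_univ]

end SignedCount

theorem choose_mul_choose_add_sub (n k j : ℕ) (hj : j ≤ n) :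
    k.choose j * (k + (n - j)).choose (n - j) = n.choose j * (n + k - j).choose n := by
  rcases le_or_gt j k with hk | hk
  · obtain ⟨a, rfl⟩ := Nat.exists_eq_add_of_le hj
    obtain ⟨b, rfl⟩ := Nat.exists_eq_add_of_le hk
    rw [show j + a - j = a by omega, show j + a + (j + b) - j = j + a + b by omega,
      Nat.choose_symm_add, mul_comm, mul_comm (Nat.choose (j + a) j)]
    have h := Nat.choose_mul (n := j + a + b) (k := j + b) (s := j) (by omega)
    have h' := Nat.choose_mul (n := j + a + b) (k := j + a) (s := j) (by omega)
    rw [show j + a + b - j = a + b by omega, Nat.add_sub_cancel_left] at h h'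
    rw [h', show j + b + a = j + a + b by omega, Nat.choose_symm_add (a := a) (b := b), ← h]
    congr 1
    · rw [show j + a + b = j + b + a by omega, Nat.choose_symm_add]
    · exact Nat.choose_symm_add.symm
  · rw [Nat.choose_eq_zero_of_lt hk, Nat.choose_eq_zero_of_lt (by omega : n + k - j < n)]
    simp

theorem natCard_sum_eq_zero_posPart_le (n k : ℕ) :
    Nat.card {v : Fin (n + 1) → ℤ // ∑ i, v i = 0 ∧ ∑ i, max (v i) 0 ≤ k} =
      Nat.card {w : Fin n → ℤ // ∑ i, max (w i) 0 ≤ k ∧ ∑ i, max (-w i) 0 ≤ k} := by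
  have key (w : Fin n → ℤ) : ∑ i, max (w i) 0 - ∑ i, max (-w i) 0 = ∑ i, w i := by
    rw [← Finset.sum_sub_distrib]
    exact Finset.sum_congr rfl fun i _ => by omega
  refine Nat.card_congr
    { toFun := fun v => ⟨Fin.tail v.1, ?_⟩
      invFun := fun w => ⟨Fin.cons (-∑ i, w.1 i) w.1, ?_⟩
      left_inv := ?_
      right_inv := ?_ }
  · obtain ⟨v, h₁, h₂⟩ := v
    rw [Fin.sum_univ_succ] at h₁ h₂
    have := key (Fin.tail v)
    simp only [Fin.tail] at this ⊢
    omega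
  · obtain ⟨w, h₁, h₂⟩ := w
    have := key w
    simp only [Fin.sum_univ_succ, Fin.cons_zero, Fin.cons_succ]
    omega
  · rintro ⟨v, h₁, h₂⟩
    rw [Fin.sum_univ_succ] at h₁
    have : -∑ i, Fin.tail v i = v 0 := by
      simp only [Fin.tail]
      omega
    simp [this]
  · rintro ⟨w, h⟩
    simp

section RootPolytope

theorem zero_mem_convexHull_roots {ι : Type*} [DecidableEq ι] [Nontrivial ι] :
    (0 : ι → ℝ) ∈
      convexHull ℝ {x : ι → ℝ | ∃ i j : ι, i ≠ j ∧ x = Pi.single i 1 - Pi.single j 1} := by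
  obtain ⟨i, j, hij⟩ := exists_pair_ne ι
  have h := (convex_convexHull ℝ
    {x : ι → ℝ | ∃ i j : ι, i ≠ j ∧ x = Pi.single i 1 - Pi.single j 1})
    (subset_convexHull ℝ _ ⟨i, j, hij, rfl⟩) (subset_convexHull ℝ _ ⟨j, i, hij.symm, rfl⟩)
    (by norm_num : (0 : ℝ) ≤ 1 / 2) (by norm_num : (0 : ℝ) ≤ 1 / 2) (by norm_num)
  convert h using 1
  module

variable {ι : Type*} [Fintype ι] [DecidableEq ι]

theorem convexHull_roots_subset :
    convexHull ℝ {x : ι → ℝ | ∃ i j : ι, i ≠ j ∧ x = Pi.single i 1 - Pi.single j 1} ⊆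
      {x | ∑ i, x i = 0 ∧ ∑ i, max (x i) 0 ≤ 1} := by
  refine convexHull_min ?_ ?_
  · rintro _ ⟨i, j, -, rfl⟩
    refine ⟨by simp, ?_⟩
    calc ∑ l, max ((Pi.single i 1 - Pi.single j 1 : ι → ℝ) l) 0
        ≤ ∑ l, (Pi.single i 1 : ι → ℝ) l := Finset.sum_le_sum fun l _ => by
          have h₁ : 0 ≤ (Pi.single i 1 : ι → ℝ) l := by rw [Pi.single_apply]; split_ifs <;> simp
          have h₂ : 0 ≤ (Pi.single j 1 : ι → ℝ) l := by rw [Pi.single_apply]; split_ifs <;> simp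
          exact max_le (by simpa using h₂) h₁
      _ ≤ 1 := by simp
  · rintro x ⟨hx, hx'⟩ y ⟨hy, hy'⟩ a b ha hb hab
    refine ⟨?_, ?_⟩
    · simp [Finset.sum_add_distrib, ← Finset.mul_sum, hx, hy]
    · calc ∑ i, max ((a • x + b • y) i) 0
          ≤ ∑ i, (a * max (x i) 0 + b * max (y i) 0) := Finset.sum_le_sum fun i _ => by
            refine max_le ?_ (by positivity)
            simp only [Pi.add_apply, Pi.smul_apply, smul_eq_mul]
            gcongr <;> exact le_max_left _ _
        _ = a * ∑ i, max (x i) 0 + b * ∑ i, max (y i) 0 := by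
            rw [Finset.sum_add_distrib, Finset.mul_sum, Finset.mul_sum]
        _ ≤ a * 1 + b * 1 := by gcongr
        _ = 1 := by linarith

theorem mem_convexHull_roots_of_sum_eq_one [Nontrivial ι] {a b : ι → ℝ} (ha : ∀ i, 0 ≤ a i)
    (hb : ∀ i, 0 ≤ b i) (ha' : ∑ i, a i = 1) (hb' : ∑ i, b i = 1) :
    a - b ∈
      convexHull ℝ {x : ι → ℝ | ∃ i j : ι, i ≠ j ∧ x = Pi.single i 1 - Pi.single j 1} := by
  have h := (convex_convexHull ℝ
    {x : ι → ℝ | ∃ i j : ι, i ≠ j ∧ x = Pi.single i 1 - Pi.single j 1}).sum_mem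
    (t := (Finset.univ : Finset (ι × ι))) (w := fun p => a p.1 * b p.2)
    (z := fun p => Pi.single p.1 1 - Pi.single p.2 1)
    (fun p _ => mul_nonneg (ha _) (hb _))
    (by rw [Fintype.sum_prod_type]; simp [← Finset.mul_sum, ha', hb'])
    (fun p _ => by
      by_cases hp : p.1 = p.2
      · rw [hp, sub_self]
        exact zero_mem_convexHull_roots
      · exact subset_convexHull ℝ _ ⟨_, _, hp, rfl⟩)
  convert h using 1
  ext l
  simp only [Fintype.sum_prod_type, Finset.sum_apply, Pi.smul_apply, Pi.sub_apply, smul_eq_mul,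
    mul_sub, Finset.sum_sub_distrib, Pi.single_apply, mul_ite, mul_one, mul_zero]
  congr 1
  · rw [Finset.sum_comm]
    simp [← Finset.mul_sum, hb']
  · simp [← Finset.sum_mul, ha']

theorem mem_smul_convexHull_roots_iff [Nontrivial ι] (x : ι → ℝ) {r : ℝ} (hr : 0 ≤ r) :
    x ∈ r • convexHull ℝ {x : ι → ℝ | ∃ i j : ι, i ≠ j ∧ x = Pi.single i 1 - Pi.single j 1} ↔
      ∑ i, x i = 0 ∧ ∑ i, max (x i) 0 ≤ r := by
  constructor
  · rintro ⟨y, hy, rfl⟩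
    obtain ⟨h₁, h₂⟩ := convexHull_roots_subset hy
    refine ⟨by simp [← Finset.mul_sum, h₁], ?_⟩
    calc ∑ i, max ((r • y) i) 0 = r * ∑ i, max (y i) 0 := by
          simp [Finset.mul_sum, mul_max_of_nonneg _ _ hr]
      _ ≤ r := mul_le_of_le_one_right hr h₂
  · rintro ⟨h₁, h₂⟩
    have hx (i : ι) : max (x i) 0 - max (-x i) 0 = x i := by
      rcases le_total (x i) 0 with h | h <;> simp [h]
    have hneg : ∑ i, max (-x i) 0 = ∑ i, max (x i) 0 := by
      refine (sub_eq_zero.1 ?_).symm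
      rw [← Finset.sum_sub_distrib, Finset.sum_congr rfl fun i _ => hx i, h₁]
    set p := ∑ i, max (x i) 0 with hp
    have hp₀ : 0 ≤ p := Finset.sum_nonneg fun i _ => le_max_right _ _
    rcases hp₀.eq_or_lt with h | h
    · have hx : x = 0 := by
        ext i
        have h₃ := (Finset.sum_eq_zero_iff_of_nonneg fun i _ => le_max_right (x i) 0).1
          (hp.symm.trans h.symm) i (Finset.mem_univ i)
        have h₄ := (Finset.sum_eq_zero_iff_of_nonneg fun i _ => le_max_right (-x i) 0).1
          (hneg.trans h.symm) i (Finset.mem_univ i)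
        have := le_max_left (x i) 0
        have := le_max_left (-x i) 0
        simp only [Pi.zero_apply]
        linarith
      exact ⟨0, zero_mem_convexHull_roots, by simp [hx]⟩
    · have hy := mem_convexHull_roots_of_sum_eq_one
        (a := fun i => max (x i) 0 / p) (b := fun i => max (-x i) 0 / p)
        (fun i => by positivity) (fun i => by positivity)
        (by rw [← Finset.sum_div, ← hp, div_self h.ne'])
        (by rw [← Finset.sum_div, hneg, div_self h.ne'])
      have hr' : 0 < r := h.trans_le h₂
      refine ⟨_, (convex_convexHull ℝ _).smul_mem_of_zero_mem zero_mem_convexHull_roots hy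
        (t := p / r) ⟨by positivity, (div_le_one hr').2 h₂⟩, ?_⟩
      ext i
      simp only [Pi.smul_apply, Pi.sub_apply, smul_eq_mul]
      rw [← sub_div, hx]
      field_simp

end RootPolytope

/-- Ehrhart counting: the number of lattice points in the k-th dilate of the root
lattice polytope of type Aₙ is ∑_j C(n,j)²·C(n+k−j, n). -/
theorem stmt_7 (n k : ℕ) (hn : 1 ≤ n) :
    Set.ncard {v : Fin (n + 1) → ℤ |
        (fun i => (v i : ℝ)) ∈ (k : ℝ) • convexHull ℝ
          {x : Fin (n + 1) → ℝ |
            ∃ i j : Fin (n + 1), i ≠ j ∧ x = Pi.single i 1 - Pi.single j 1}} =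
      ∑ j ∈ Finset.range (n + 1), n.choose j ^ 2 * (n + k - j).choose n := by
  have : Nontrivial (Fin (n + 1)) := Fin.nontrivial_iff_two_le.2 (by omega)
  have h (v : Fin (n + 1) → ℤ) : (fun i => (v i : ℝ)) ∈ (k : ℝ) • convexHull ℝ
      {x : Fin (n + 1) → ℝ |
        ∃ i j : Fin (n + 1), i ≠ j ∧ x = Pi.single i 1 - Pi.single j 1} ↔
      ∑ i, v i = 0 ∧ ∑ i, max (v i) 0 ≤ k := by
    rw [mem_smul_convexHull_roots_iff _ k.cast_nonneg]
    norm_cast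
  simp only [h]
  rw [← Nat.card_coe_set_eq]
  refine (natCard_sum_eq_zero_posPart_le n k).trans ?_
  rw [natCard_posPart_negPart_le, Fintype.card_fin]
  refine Finset.sum_congr rfl fun j hj => ?_
  rw [choose_mul_choose_add_sub n k j (by simpa [Nat.lt_succ_iff] using hj)]
  ring
end

section
/- Let n ≥ 1 and let ε_1, …, ε_n denote the standard basis of ℝⁿ. Define Q_n := conv({ε_i : 1 ≤ i ≤ n} ∪ {−ε_i : 1 ≤ i ≤ n} ∪ {ε_j − ε_i : 1 ≤ i, j ≤ n, i ≠ j}). Then the n-dimensional Lebesgue measure of Q_n equals C(2n, n)/n!, where C(2n, n) denotes the central binomial coefficient (2n)!/(n!·n!). -/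
open MeasureTheory Finset

/-- The nonnegative vectors of coordinate sum at most `1` form the standard corner simplex. -/
theorem mem_convexHull_insert_zero_single {ι : Type*} [Fintype ι] [DecidableEq ι] {u : ι → ℝ}
    (hu : ∀ i, 0 ≤ u i) (hs : ∑ i, u i ≤ 1) :
    u ∈ convexHull ℝ (insert 0 (Set.range fun i : ι => (Pi.single i 1 : ι → ℝ))) := by
  have key := (convex_convexHull ℝ
      (insert 0 (Set.range fun i : ι => (Pi.single i 1 : ι → ℝ)))).sum_mem
    (t := (univ : Finset (Option ι))) (w := fun o => o.elim (1 - ∑ i, u i) u)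
    (z := fun o => o.elim 0 fun i => Pi.single i 1)
    (by rintro (_ | i) - <;> simp [hu, hs])
    (by simp [Fintype.sum_option])
    (by
      rintro (_ | i) -
      · exact subset_convexHull ℝ _ (Set.mem_insert _ _)
      · exact subset_convexHull ℝ _ (Set.mem_insert_of_mem _ ⟨i, rfl⟩))
  convert key using 1
  ext j
  simp [Fintype.sum_option, Finset.sum_apply, Pi.single_apply]

theorem convex_sum_max_zero_le {ι : Type*} [Fintype ι] (a b : ℝ) :
    Convex ℝ {x : ι → ℝ | ∑ i, max (x i) 0 ≤ a ∧ ∑ i, max (-x i) 0 ≤ b} := by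
  rintro x ⟨hxa, hxb⟩ y ⟨hya, hyb⟩ s t hs ht hst
  have aux : ∀ (u v : ι → ℝ) (c : ℝ), ∑ i, max (u i) 0 ≤ c → ∑ i, max (v i) 0 ≤ c →
      ∑ i, max (s * u i + t * v i) 0 ≤ c := by
    intro u v c hu hv
    calc ∑ i, max (s * u i + t * v i) 0
        ≤ ∑ i, (s * max (u i) 0 + t * max (v i) 0) := by
          refine sum_le_sum fun i _ => max_le ?_ ?_
          · gcongr <;> exact le_max_left _ _
          · positivity
      _ = s * ∑ i, max (u i) 0 + t * ∑ i, max (v i) 0 := by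
          rw [sum_add_distrib, mul_sum, mul_sum]
      _ ≤ s * c + t * c := by gcongr
      _ = c := by rw [← add_mul, hst, one_mul]
  refine ⟨by simpa using aux x y a hxa hya, ?_⟩
  have := aux (-x) (-y) b (by simpa using hxb) (by simpa using hyb)
  convert this using 3 with i
  simp
  ring

/-- The root polytope of type `A` is cut out by bounding the positive and the negative parts. -/
theorem convexHull_roots_eq {ι : Type*} [Fintype ι] [DecidableEq ι] [Nonempty ι] :
    convexHull ℝ
        ({x : ι → ℝ | ∃ i, x = Pi.single i 1} ∪
          {x : ι → ℝ | ∃ i, x = -Pi.single i 1} ∪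
          {x : ι → ℝ | ∃ i j : ι, i ≠ j ∧ x = Pi.single j 1 - Pi.single i 1}) =
      {x : ι → ℝ | ∑ i, max (x i) 0 ≤ 1 ∧ ∑ i, max (-x i) 0 ≤ 1} := by
  set G := {x : ι → ℝ | ∃ i, x = Pi.single i 1} ∪
          {x : ι → ℝ | ∃ i, x = -Pi.single i 1} ∪
          {x : ι → ℝ | ∃ i j : ι, i ≠ j ∧ x = Pi.single j 1 - Pi.single i 1}
  have hpos (i : ι) : Pi.single i 1 ∈ convexHull ℝ G :=
    subset_convexHull ℝ _ (Or.inl (Or.inl ⟨i, rfl⟩))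
  have hneg (i : ι) : -Pi.single i 1 ∈ convexHull ℝ G :=
    subset_convexHull ℝ _ (Or.inl (Or.inr ⟨i, rfl⟩))
  have hzero : (0 : ι → ℝ) ∈ convexHull ℝ G := by
    obtain ⟨i⟩ := ‹Nonempty ι›
    have := convex_convexHull ℝ G (hpos i) (hneg i) (a := 1 / 2) (b := 1 / 2)
      (by norm_num) (by norm_num) (by norm_num)
    simpa using this
  apply Set.Subset.antisymm
  · refine convexHull_min ?_ (convex_sum_max_zero_le 1 1)
    have h1 (i k : ι) : max ((Pi.single i 1 : ι → ℝ) k) 0 = (Pi.single i 1 : ι → ℝ) k :=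
      max_eq_left (by by_cases h : k = i <;> simp [h])
    have h2 (i k : ι) : max (-(Pi.single i 1 : ι → ℝ) k) 0 = 0 :=
      max_eq_right (by by_cases h : k = i <;> simp [h])
    have h3 (i j k : ι) : max ((Pi.single j 1 : ι → ℝ) k - (Pi.single i 1 : ι → ℝ) k) 0 ≤
        (Pi.single j 1 : ι → ℝ) k := by
      by_cases h : k = i <;> by_cases h' : k = j <;> simp [Pi.single_apply, h, h'] <;> split_ifs <;>
        norm_num
    rintro x ((⟨i, rfl⟩ | ⟨i, rfl⟩) | ⟨i, j, -, rfl⟩)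
    · simp [h1, h2]
    · simp [h1, h2]
    · refine ⟨(sum_le_sum fun k _ => h3 i j k).trans (by simp), ?_⟩
      simp only [Pi.sub_apply, neg_sub]
      exact (sum_le_sum fun k _ => h3 j i k).trans (by simp)
  · rintro x ⟨hp, hq⟩
    have hx : x = (fun i => max (x i) 0) - fun i => max (-x i) 0 := by
      ext i
      rcases le_total 0 (x i) with h | h <;> simp [h]
    have hmem := Set.sub_mem_sub
      (mem_convexHull_insert_zero_single (fun i => le_max_right (x i) 0) hp)
      (mem_convexHull_insert_zero_single (fun i => le_max_right (-x i) 0) hq)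
    rw [← hx, ← convexHull_sub] at hmem
    refine convexHull_min ?_ (convex_convexHull ℝ G) hmem
    rintro _ ⟨_, (rfl | ⟨j, rfl⟩), _, (rfl | ⟨i, rfl⟩), rfl⟩
    · simpa using hzero
    · simpa using hneg i
    · simpa using hpos j
    · by_cases h : i = j
      · simpa [h] using hzero
      · exact subset_convexHull ℝ _ (Or.inr ⟨i, j, h, rfl⟩)

theorem integral_sub_pow_div_factorial (a : ℝ) (k : ℕ) :
    ∫ t in 0..a, (a - t) ^ k / (k.factorial : ℝ) = a ^ (k + 1) / ((k + 1).factorial : ℝ) := by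
  rw [intervalIntegral.integral_comp_sub_left (fun t => t ^ k / (k.factorial : ℝ)) a,
    intervalIntegral.integral_div, integral_pow, Nat.factorial_succ]
  push_cast
  simp
  field_simp

/-- The volume of `{x | ∑ x⁺ ≤ a, ∑ x⁻ ≤ b}` in dimension `n`, see
`volume_sum_max_zero_le`. -/
noncomputable def signedSimplexVolume (n : ℕ) (a b : ℝ) : ℝ :=
  ∑ p ∈ antidiagonal n, (n.choose p.1 : ℝ) *
    (a ^ p.1 / (p.1.factorial : ℝ) * (b ^ p.2 / (p.2.factorial : ℝ)))

theorem signedSimplexVolume_nonneg (n : ℕ) {a b : ℝ} (ha : 0 ≤ a) (hb : 0 ≤ b) :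
    0 ≤ signedSimplexVolume n a b :=
  sum_nonneg fun _ _ => by positivity

@[fun_prop]
theorem continuous_signedSimplexVolume (n : ℕ) {X : Type*} [TopologicalSpace X] {f g : X → ℝ}
    (hf : Continuous f) (hg : Continuous g) :
    Continuous fun x => signedSimplexVolume n (f x) (g x) := by
  unfold signedSimplexVolume
  fun_prop

theorem integral_signedSimplexVolume (n : ℕ) (a b : ℝ) :
    (∫ t in 0..a, signedSimplexVolume n (a - t) b) +
      ∫ t in 0..b, signedSimplexVolume n a (b - t) = signedSimplexVolume (n + 1) a b := by
  have h1 : ∫ t in 0..a, signedSimplexVolume n (a - t) b =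
      ∑ p ∈ antidiagonal n, (n.choose p.2 : ℝ) *
        (a ^ (p.1 + 1) / ((p.1 + 1).factorial : ℝ) * (b ^ p.2 / (p.2.factorial : ℝ))) := by
    unfold signedSimplexVolume
    rw [intervalIntegral.integral_finsetSum
      fun p _ => Continuous.intervalIntegrable (by fun_prop) _ _]
    refine sum_congr rfl fun p hp => ?_
    rw [intervalIntegral.integral_const_mul, intervalIntegral.integral_mul_const,
      integral_sub_pow_div_factorial, Nat.choose_symm_of_eq_add (mem_antidiagonal.mp hp).symm]
  have h2 : ∫ t in 0..b, signedSimplexVolume n a (b - t) =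
      ∑ p ∈ antidiagonal n, (n.choose p.1 : ℝ) *
        (a ^ p.1 / (p.1.factorial : ℝ) * (b ^ (p.2 + 1) / ((p.2 + 1).factorial : ℝ))) := by
    unfold signedSimplexVolume
    rw [intervalIntegral.integral_finsetSum
      fun p _ => Continuous.intervalIntegrable (by fun_prop) _ _]
    refine sum_congr rfl fun p hp => ?_
    rw [intervalIntegral.integral_const_mul, intervalIntegral.integral_const_mul,
      integral_sub_pow_div_factorial]
  rw [h1, h2, add_comm, signedSimplexVolume,
    sum_antidiagonal_choose_succ_mul (fun i j => a ^ i / (i.factorial : ℝ) *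
      (b ^ j / (j.factorial : ℝ))) n]

theorem signedSimplexVolume_one_one (n : ℕ) :
    signedSimplexVolume n 1 1 = ((2 * n).choose n : ℝ) / (n.factorial : ℝ) := by
  rw [two_mul, Nat.add_choose_eq, Nat.cast_sum, sum_div]
  refine sum_congr rfl fun p hp => ?_
  obtain ⟨i, j⟩ := p
  obtain rfl : i + j = n := mem_antidiagonal.mp hp
  have h := Nat.add_choose_mul_factorial_mul_factorial i j
  have hs : (i + j).choose j = (i + j).choose i := Nat.choose_symm_add.symm
  rw [hs]
  have h' : ((i + j).choose i : ℝ) * i.factorial * j.factorial = (i + j).factorial := by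
    exact_mod_cast hs ▸ h
  push_cast
  rw [← h']
  have : ((i + j).choose i : ℝ) ≠ 0 :=
    Nat.cast_ne_zero.mpr (Nat.choose_pos (Nat.le_add_right i j)).ne'
  field_simp
  simp

theorem lintegral_Icc_ofReal_eq {f : ℝ → ℝ} {a b : ℝ} (hab : a ≤ b) (hf : Continuous f)
    (h0 : ∀ t ∈ Set.Icc a b, 0 ≤ f t) :
    ∫⁻ t in Set.Icc a b, ENNReal.ofReal (f t) = ENNReal.ofReal (∫ t in a..b, f t) := by
  rw [intervalIntegral.integral_of_le hab, ← integral_Icc_eq_integral_Ioc,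
    ofReal_integral_eq_lintegral_ofReal hf.continuousOn.integrableOn_Icc
      ((ae_restrict_iff' measurableSet_Icc).mpr (ae_of_all _ h0))]

theorem volume_sum_max_zero_le (n : ℕ) {a b : ℝ} (ha : 0 ≤ a) (hb : 0 ≤ b) :
    volume {x : Fin n → ℝ | ∑ i, max (x i) 0 ≤ a ∧ ∑ i, max (-x i) 0 ≤ b} =
      ENNReal.ofReal (signedSimplexVolume n a b) := by
  induction n generalizing a b with
  | zero => simp [signedSimplexVolume, ha, hb, volume_pi]
  | succ n ih =>
    have hslice (t : ℝ) : volume {y : Fin n → ℝ | max t 0 + ∑ i, max (y i) 0 ≤ a ∧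
          max (-t) 0 + ∑ i, max (-y i) 0 ≤ b} =
        (Set.Icc 0 a).indicator (fun t => ENNReal.ofReal (signedSimplexVolume n (a - t) b)) t +
        (Set.Ico (-b) 0).indicator
          (fun t => ENNReal.ofReal (signedSimplexVolume n a (b + t))) t := by
      by_cases hmem : t ∈ Set.Icc (-b) a
      · rcases le_or_gt 0 t with h | h
        · rw [Set.indicator_of_mem (Set.mem_Icc.mpr ⟨h, hmem.2⟩),
            Set.indicator_of_notMem (fun h' => h'.2.not_ge h),
            add_zero, ← ih (sub_nonneg.mpr hmem.2) hb]
          simp [h, le_sub_iff_add_le']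
        · rw [Set.indicator_of_notMem (fun h' => h'.1.not_gt h),
            Set.indicator_of_mem (Set.mem_Ico.mpr ⟨hmem.1, h⟩),
            zero_add, ← ih ha (by linarith [hmem.1])]
          have h1 : max t 0 = 0 := max_eq_right h.le
          have h2 : max (-t) 0 = -t := max_eq_left (by linarith)
          simp only [h1, h2, zero_add, neg_add_le_iff_le_add, add_comm t b]
      · rw [Set.indicator_of_notMem fun h => hmem ⟨by linarith [h.1], h.2⟩,
          Set.indicator_of_notMem fun h => hmem ⟨h.1, by linarith [h.2]⟩, add_zero]
        convert measure_empty (μ := (volume : Measure (Fin n → ℝ)))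
        rw [Set.eq_empty_iff_forall_notMem]
        rintro y ⟨h1, h2⟩
        have h3 : 0 ≤ ∑ i, max (y i) 0 := sum_nonneg fun i _ => le_max_right _ _
        have h4 : 0 ≤ ∑ i, max (-y i) 0 := sum_nonneg fun i _ => le_max_right _ _
        exact hmem ⟨by linarith [le_max_left (-t) 0], by linarith [le_max_left t 0]⟩
    have hpre : {x : Fin (n + 1) → ℝ | ∑ i, max (x i) 0 ≤ a ∧ ∑ i, max (-x i) 0 ≤ b} =
        MeasurableEquiv.piFinSuccAbove (fun _ => ℝ) 0 ⁻¹'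
          {q : ℝ × (Fin n → ℝ) | max q.1 0 + ∑ i, max (q.2 i) 0 ≤ a ∧
            max (-q.1) 0 + ∑ i, max (-q.2 i) 0 ≤ b} := by
      ext x
      simp [Fin.sum_univ_succ, MeasurableEquiv.piFinSuccAbove, Fin.tail]
    have hmeas : MeasurableSet {q : ℝ × (Fin n → ℝ) | max q.1 0 + ∑ i, max (q.2 i) 0 ≤ a ∧
        max (-q.1) 0 + ∑ i, max (-q.2 i) 0 ≤ b} := by
      rw [Set.ofPred_and]
      exact (measurableSet_le (by fun_prop) (by fun_prop)).inter
        (measurableSet_le (by fun_prop) (by fun_prop))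
    have hneg : ∫ t in (-b)..0, signedSimplexVolume n a (b + t) =
        ∫ t in 0..b, signedSimplexVolume n a (b - t) := by
      simp
    rw [hpre, (volume_preserving_piFinSuccAbove (fun _ => ℝ) 0).measure_preimage
      hmeas.nullMeasurableSet, Measure.volume_eq_prod, Measure.prod_apply hmeas]
    simp only [Set.preimage_ofPred_eq, hslice]
    rw [lintegral_add_left (Measurable.indicator (by fun_prop) measurableSet_Icc),
      lintegral_indicator measurableSet_Icc, lintegral_indicator measurableSet_Ico,
      setLIntegral_congr Ico_ae_eq_Icc,
      lintegral_Icc_ofReal_eq ha (by fun_prop)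
        fun t ht => signedSimplexVolume_nonneg n (by linarith [ht.2]) hb,
      lintegral_Icc_ofReal_eq (by linarith) (by fun_prop)
        fun t ht => signedSimplexVolume_nonneg n ha (by linarith [ht.1]),
      ← ENNReal.ofReal_add, hneg, integral_signedSimplexVolume]
    · exact intervalIntegral.integral_nonneg ha
        fun t ht => signedSimplexVolume_nonneg n (by linarith [ht.2]) hb
    · exact intervalIntegral.integral_nonneg (by linarith)
        fun t ht => signedSimplexVolume_nonneg n ha (by linarith [ht.1])

/-- The g-polytope of the star-shaped Brauer tree algebra with n edges has volume
C(2n,n)/n!. -/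
theorem stmt_9 (n : ℕ) (hn : 1 ≤ n) :
    MeasureTheory.volume (convexHull ℝ
        ({x : Fin n → ℝ | ∃ i, x = Pi.single i 1} ∪
          {x : Fin n → ℝ | ∃ i, x = -Pi.single i 1} ∪
          {x : Fin n → ℝ | ∃ i j : Fin n, i ≠ j ∧ x = Pi.single j 1 - Pi.single i 1})) =
      ENNReal.ofReal (((2 * n).choose n : ℝ) / (n.factorial : ℝ)) := by
  have : Nonempty (Fin n) := ⟨⟨0, hn⟩⟩
  rw [convexHull_roots_eq, volume_sum_max_zero_le n zero_le_one zero_le_one,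
    signedSimplexVolume_one_one]
end
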